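/- Let f, g, p, q be nonconstant polynomials over ℂ such that f ∘ p = g ∘ q, the bivariate polynomial f(X) − g(Y) is irreducible in ℂ[X,Y], and p and q have no nontrivial common right compositional factor. Then for every z ∈ ℂ, the local degree of h = f ∘ p at z satisfies e_z(h) = lcm(e_{p(z)}(f), e_{q(z)}(g)). -/

import Mathlib

open Polynomial

/-- The local degree of a polynomial `p` at a point `z`: the multiplicity of `z`
as a root of `p(X) - p(z)`. -/
noncomputable def localDeg (p : Polynomial ℂ) (z : ℂ) : ℕ :=
  rootMultiplicity z (p - C (p.eval z))

/-- `p` and `q` have no nontrivial common right compositional factor. -/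
def NoCommonRightFactor (p q : Polynomial ℂ) : Prop :=
  ∀ p₁ q₁ W : Polynomial ℂ, p = p₁.comp W → q = q₁.comp W → W.natDegree ≤ 1

/-- The bivariate polynomial `f(X) - g(Y)`, viewed as an element of `(ℂ[X])[Y]`. -/
noncomputable def curvePoly (f g : Polynomial ℂ) : Polynomial (Polynomial ℂ) :=
  C f - g.map C

/-- `ν_h(w)`: the least common multiple of the local degrees of `h` over the fiber
`h⁻¹(w)`. -/
noncomputable def nuPoly (h : Polynomial ℂ) (w : ℂ) : ℕ :=
  ((h - C w).roots.toFinset).lcm (localDeg h)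

/-- `ν¹_h(u) = ν_h(h(u)) / e_u(h)`. -/
noncomputable def nuOnePoly (h : Polynomial ℂ) (u : ℂ) : ℕ :=
  nuPoly h (h.eval u) / localDeg h u

section CompositionalFactor

open scoped RatFunc IntermediateField IntermediateField.algebraAdjoinAdjoin

lemma aeval_algebraMap_ratFunc {K : Type*} [Field K] (r W : K[X]) :
    aeval (algebraMap K[X] K⟮X⟯ W) r = algebraMap K[X] K⟮X⟯ (r.comp W) := by
  rw [aeval_algebraMap_apply, ← comp_eq_aeval]

/-- A polynomial which is a rational function of a nonconstant polynomial `W` is a polynomial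
in `W`. -/
lemma exists_eq_comp_of_mem_adjoin {K : Type*} [Field K] {p W : K[X]} (hW : 0 < W.natDegree)
    (h : algebraMap K[X] K⟮X⟯ p ∈ K⟮algebraMap K[X] K⟮X⟯ W⟯) :
    ∃ p₁ : K[X], p = p₁.comp W := by
  obtain ⟨r, s, hrs⟩ := (IntermediateField.mem_adjoin_simple_iff _ _).mp h
  rw [aeval_algebraMap_ratFunc, aeval_algebraMap_ratFunc] at hrs
  have hinj := RatFunc.algebraMap_injective K
  by_cases hs : s.comp W = 0
  · refine ⟨0, hinj ?_⟩
    rw [hrs, hs]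
    simp
  have hs' : algebraMap K[X] K⟮X⟯ (s.comp W) ≠ 0 := by
    rwa [Ne, map_eq_zero_iff _ hinj]
  have hmul : p * s.comp W = r.comp W := hinj (by rw [map_mul, hrs, div_mul_cancel₀ _ hs'])
  have hs0 : s ≠ 0 := by
    rintro rfl
    simp at hs
  have hdiv : (r % s).comp W = s.comp W * (p - (r / s).comp W) := by
    have := congrArg (fun t => t.comp W) (EuclideanDomain.div_add_mod r s)
    simp only [add_comp, mul_comp] at this
    linear_combination this - hmul
  refine ⟨r / s, sub_eq_zero.mp (by_contra fun hne => ?_)⟩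
  have hmod : r % s ≠ 0 := by
    intro h0
    rw [h0, zero_comp] at hdiv
    exact mul_ne_zero hs hne hdiv.symm
  have hlt : (r % s).natDegree < s.natDegree :=
    natDegree_lt_natDegree hmod (EuclideanDomain.mod_lt r hs0)
  have hdeg := congrArg natDegree hdiv
  rw [natDegree_mul hs hne, natDegree_comp, natDegree_comp] at hdeg
  have := Nat.mul_lt_mul_of_pos_right hlt hW
  omega

/-- If a simple subextension of `K(X)` contains a nonconstant polynomial, then it is generated by
a polynomial. -/
lemma exists_adjoin_algebraMap_eq {K : Type*} [Field K] (θ : K⟮X⟯) {p : K[X]}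
    (hp : 0 < p.natDegree) (hpθ : algebraMap K[X] K⟮X⟯ p ∈ K⟮θ⟯) :
    ∃ W : K[X], 0 < W.natDegree ∧ K⟮algebraMap K[X] K⟮X⟯ W⟯ = K⟮θ⟯ := by
  have hinj := RatFunc.algebraMap_injective K
  wlog hmonic : p.Monic generalizing p
  · have hl : p.leadingCoeff ≠ 0 := leadingCoeff_ne_zero.mpr (ne_zero_of_natDegree_gt hp)
    refine this (p := p * C p.leadingCoeff⁻¹) ?_ ?_ (monic_mul_leadingCoeff_inv ?_)
    · rwa [natDegree_mul_C (inv_ne_zero hl)]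
    · rw [map_mul]
      exact mul_mem hpθ (K⟮θ⟯.algebraMap_mem p.leadingCoeff⁻¹)
    · exact ne_zero_of_natDegree_gt hp
  have hθ : ¬ ∃ c, θ = RatFunc.C c := by
    rintro ⟨c, rfl⟩
    rw [IntermediateField.adjoin_simple_eq_bot_iff.mpr
      (show RatFunc.C c ∈ (⊥ : IntermediateField K K⟮X⟯) from ⟨c, rfl⟩)] at hpθ
    obtain ⟨d, hd⟩ := IntermediateField.mem_bot.mp hpθ
    have : C d = p := hinj (by rw [← hd]; rfl)
    rw [← this, natDegree_C] at hp
    exact hp.false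
  set M := θ.minpolyX K⟮θ⟯ with hM
  set L : K⟮X⟯[X] := M.map (algebraMap K⟮θ⟯ K⟮X⟯) with hL
  have hMirr : Irreducible M := θ.irreducible_minpolyX hθ
  have hL0 : L ≠ 0 :=
    (Polynomial.map_ne_zero_iff (algebraMap K⟮θ⟯ K⟮X⟯).injective).mpr hMirr.ne_zero
  have hLcoeff (i : ℕ) :
      L.coeff i = RatFunc.C (θ.num.coeff i) - θ * RatFunc.C (θ.denom.coeff i) := by
    simp [hL, hM, RatFunc.minpolyX]
  have hLX : L.eval RatFunc.X = 0 := by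
    rw [hL, eval_map_algebraMap]
    exact θ.minpolyX_aeval_X
  have hF : (p.map C - C p : K[X][X]).Monic := by
    refine (hmonic.map C).sub_of_left (degree_C_le.trans_lt ?_)
    rw [degree_map]
    exact natDegree_pos_iff_degree_pos.mp hp
  have hdvd : L ∣ (p.map C - C p : K[X][X]).map (algebraMap K[X] K⟮X⟯) := by
    have h1 : M ∣ p.map (algebraMap K K⟮θ⟯) - C ⟨_, hpθ⟩ := by
      have h2 : M ∣ minpoly K⟮θ⟯ (RatFunc.X : K⟮X⟯) := by
        rw [← minpoly.eq_of_irreducible hMirr θ.minpolyX_aeval_X]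
        exact dvd_mul_right _ _
      refine h2.trans (minpoly.dvd _ _ ?_)
      simp [aeval_map_algebraMap]
    have h3 := Polynomial.map_dvd (algebraMap K⟮θ⟯ K⟮X⟯) h1
    convert h3 using 1
    ext i
    simp [Polynomial.map_map]
  obtain ⟨G, hG⟩ := IsIntegrallyClosed.eq_map_mul_C_of_dvd K⟮X⟯ hF hdvd
  set l := L.leadingCoeff with hl
  have hl0 : l ≠ 0 := leadingCoeff_ne_zero.mpr hL0
  obtain ⟨i, hi⟩ : ∃ i, 0 < (G.coeff i).natDegree := by
    by_contra! hcon
    have hGC : G = (G.map (evalRingHom 0)).map C := by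
      ext1 i
      rw [coeff_map, coeff_map, eq_C_of_natDegree_le_zero (hcon i)]
      simp
    set H := G.map (evalRingHom 0)
    rw [← hG, eval_mul, eval_C, mul_eq_zero, or_iff_left hl0, hGC, Polynomial.map_map] at hLX
    have hH : H = 0 := by
      apply hinj
      rw [map_zero, ← hLX, ← RatFunc.aeval_X_left_eq_algebraMap, aeval_def, eval_map]
      rfl
    rw [hGC, hH] at hG
    exact hL0 (by rw [← hG]; simp)
  have hW : algebraMap K[X] K⟮X⟯ (G.coeff i) * l = L.coeff i := by
    rw [← hG, coeff_mul_C, coeff_map]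
  refine ⟨G.coeff i, hi, ?_⟩
  set W := algebraMap K[X] K⟮X⟯ (G.coeff i) with hWdef
  have hWC (c : K) : W ≠ RatFunc.C c := by
    intro h
    have : G.coeff i = C c := hinj (by rw [← hWdef, h]; rfl)
    rw [this, natDegree_C] at hi
    exact hi.false
  obtain ⟨n, hn⟩ : ∃ n, l = L.coeff n := ⟨_, rfl⟩
  rw [hLcoeff] at hn hW
  set a := θ.num.coeff n
  set b := θ.denom.coeff n
  set a' := θ.num.coeff i
  set b' := θ.denom.coeff i
  have hCmem (F : IntermediateField K K⟮X⟯) (c : K) : RatFunc.C c ∈ F := F.algebraMap_mem c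
  apply le_antisymm
  · rw [IntermediateField.adjoin_simple_le_iff, eq_div_of_mul_eq hl0 hW, hn]
    have hθm := IntermediateField.mem_adjoin_simple_self K θ
    exact div_mem (sub_mem (hCmem _ _) (mul_mem hθm (hCmem _ _)))
      (sub_mem (hCmem _ _) (mul_mem hθm (hCmem _ _)))
  · rw [IntermediateField.adjoin_simple_le_iff]
    have hWm := IntermediateField.mem_adjoin_simple_self K W
    have hrel : θ * (RatFunc.C b' - W * RatFunc.C b) = RatFunc.C a' - W * RatFunc.C a := by
      rw [hn] at hW
      linear_combination hW
    have hb : RatFunc.C b' - W * RatFunc.C b ≠ 0 := by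
      intro h0
      rw [h0, mul_zero] at hrel
      have aux (c c' : K) (h : RatFunc.C c' - W * RatFunc.C c = 0) : c = 0 := by
        by_contra hc
        have hc' : (RatFunc.C c : K⟮X⟯) ≠ 0 := (_root_.map_ne_zero RatFunc.C).mpr hc
        exact hWC (c' / c) (by rw [map_div₀, eq_div_iff hc', ← sub_eq_zero.mp h])
      apply hl0
      rw [hn, aux a a' hrel.symm, aux b b' h0]
      simp
    rw [eq_div_of_mul_eq hb hrel]
    exact div_mem (sub_mem (hCmem _ _) (mul_mem hWm (hCmem _ _)))
      (sub_mem (hCmem _ _) (mul_mem hWm (hCmem _ _)))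

lemma exists_ne_zero_and_eq_mul_of_mem_adjoin {K : Type*} [Field K] {p q x : K[X]}
    (h : algebraMap K[X] K⟮X⟯ x ∈ K⟮algebraMap K[X] K⟮X⟯ p, algebraMap K[X] K⟮X⟯ q⟯) :
    ∃ r ∈ Algebra.adjoin K {p, q}, ∃ s ∈ Algebra.adjoin K {p, q}, s ≠ 0 ∧ x * s = r := by
  have hinj := RatFunc.algebraMap_injective K
  have himg : ∀ r ∈ Algebra.adjoin K {algebraMap K[X] K⟮X⟯ p, algebraMap K[X] K⟮X⟯ q},
      ∃ r' ∈ Algebra.adjoin K {p, q}, algebraMap K[X] K⟮X⟯ r' = r := by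
    intro r hr
    have := AlgHom.map_adjoin (IsScalarTower.toAlgHom K K[X] K⟮X⟯) {p, q}
    rw [Set.image_pair] at this
    change r ∈ Algebra.adjoin K {IsScalarTower.toAlgHom K K[X] K⟮X⟯ p,
      IsScalarTower.toAlgHom K K[X] K⟮X⟯ q} at hr
    rw [← this] at hr
    exact Subalgebra.mem_map.mp hr
  obtain ⟨r, hr, s, hs, hrs⟩ := IntermediateField.mem_adjoin_iff_div.mp h
  obtain ⟨r, hr', rfl⟩ := himg r hr
  obtain ⟨s, hs', rfl⟩ := himg s hs
  by_cases hs0 : s = 0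
  · refine ⟨0, zero_mem _, 1, one_mem _, one_ne_zero, ?_⟩
    rw [mul_one]
    apply hinj
    rw [hrs, hs0]
    simp
  · refine ⟨r, hr', s, hs', hs0, hinj ?_⟩
    rw [map_mul, hrs, div_mul_cancel₀]
    rwa [Ne, map_eq_zero_iff _ hinj]

lemma eval_eq_eval_of_mem_adjoin {K : Type*} [Field K] {p q r : K[X]}
    (hr : r ∈ Algebra.adjoin K {p, q}) {x y : K} (hp : p.eval x = p.eval y)
    (hq : q.eval x = q.eval y) : r.eval x = r.eval y := by
  have : Algebra.adjoin K {p, q} ≤ AlgHom.equalizer (aeval x : K[X] →ₐ[K] K) (aeval y) := by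
    rw [Algebra.adjoin_le_iff]
    rintro _ (rfl | rfl)
    · simpa using hp
    · simpa using hq
  simpa using this hr

/-- The map `z ↦ (p z, q z)` is injective off a finite set. -/
lemma NoCommonRightFactor.exists_injective {p q : ℂ[X]} (h : NoCommonRightFactor p q)
    (hp : 0 < p.natDegree) :
    ∃ s : ℂ[X], s ≠ 0 ∧
      ∀ x y, p.eval x = p.eval y → q.eval x = q.eval y → s.eval x ≠ 0 → x = y := by
  set ι := algebraMap ℂ[X] ℂ⟮X⟯
  have hpE : ι p ∈ ℂ⟮ι p, ι q⟯ := IntermediateField.mem_adjoin_pair_left _ _ _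
  have hqE : ι q ∈ ℂ⟮ι p, ι q⟯ := IntermediateField.mem_adjoin_pair_right _ _ _
  obtain ⟨W, hW, hWE⟩ := exists_adjoin_algebraMap_eq (RatFunc.Luroth.generator ℂ⟮ι p, ι q⟯) hp
    (by rwa [← RatFunc.Luroth.eq_adjoin_generator])
  rw [← RatFunc.Luroth.eq_adjoin_generator] at hWE
  obtain ⟨p₁, hp₁⟩ := exists_eq_comp_of_mem_adjoin (p := p) hW (by rwa [hWE])
  obtain ⟨q₁, hq₁⟩ := exists_eq_comp_of_mem_adjoin (p := q) hW (by rwa [hWE])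
  have hW1 : W.natDegree = 1 := le_antisymm (h p₁ q₁ W hp₁ hq₁) hW
  have hWmem : ι W ∈ ℂ⟮ι p, ι q⟯ := by
    rw [← hWE]
    exact IntermediateField.mem_adjoin_simple_self _ _
  obtain ⟨r, hr, s, hs, hs0, hrs⟩ := exists_ne_zero_and_eq_mul_of_mem_adjoin hWmem
  refine ⟨s, hs0, fun x y hpxy hqxy hsx => ?_⟩
  have hrxy := eval_eq_eval_of_mem_adjoin hr hpxy hqxy
  rw [← hrs, eval_mul, eval_mul, ← eval_eq_eval_of_mem_adjoin hs hpxy hqxy] at hrxy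
  have hWxy := mul_right_cancel₀ hsx hrxy
  obtain ⟨a, ha, b, rfl⟩ := natDegree_eq_one.mp hW1
  simpa [ha] using hWxy

end CompositionalFactor

section LocalDegree

open Filter Topology

lemma sub_C_ne_zero_of_natDegree_pos {p : ℂ[X]} (hp : 0 < p.natDegree) (c : ℂ) :
    p - C c ≠ 0 := fun h => by
  rw [sub_eq_zero.mp h, natDegree_C] at hp
  exact hp.false

lemma localDeg_pos {p : ℂ[X]} (hp : 0 < p.natDegree) (z : ℂ) : 0 < localDeg p z :=
  (rootMultiplicity_pos (sub_C_ne_zero_of_natDegree_pos hp _)).mpr (by simp)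

lemma exists_sub_C_eval_eq {p : ℂ[X]} (hp : 0 < p.natDegree) (z : ℂ) :
    ∃ r : ℂ[X], p - C (p.eval z) = (X - C z) ^ localDeg p z * r ∧ r.eval z ≠ 0 := by
  obtain ⟨r, hr, hrz⟩ := exists_eq_pow_rootMultiplicity_mul_and_not_dvd _
    (sub_C_ne_zero_of_natDegree_pos hp (p.eval z)) z
  exact ⟨r, hr, fun h => hrz (dvd_iff_isRoot.mpr h)⟩

lemma localDeg_comp {f p : ℂ[X]} (hf : 0 < f.natDegree) (hp : 0 < p.natDegree) (z : ℂ) :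
    localDeg (f.comp p) z = localDeg f (p.eval z) * localDeg p z := by
  obtain ⟨f₁, hf₁, hf₁'⟩ := exists_sub_C_eval_eq hf (p.eval z)
  obtain ⟨p₁, hp₁, hp₁'⟩ := exists_sub_C_eval_eq hp z
  have key : f.comp p - C ((f.comp p).eval z) =
      (X - C z) ^ (localDeg f (p.eval z) * localDeg p z) *
        (p₁ ^ localDeg f (p.eval z) * f₁.comp p) := by
    have := congrArg (fun F => F.comp p) hf₁
    simp only [sub_comp, C_comp, mul_comp, pow_comp, X_comp, hp₁] at this
    rw [eval_comp, this]
    ring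
  have hr : (p₁ ^ localDeg f (p.eval z) * f₁.comp p).eval z ≠ 0 := by
    simp [eval_comp, hf₁', hp₁']
  have hr0 : p₁ ^ localDeg f (p.eval z) * f₁.comp p ≠ 0 := fun h => hr (by rw [h, eval_zero])
  rw [localDeg, key, rootMultiplicity_mul
    (mul_ne_zero (pow_ne_zero _ (X_sub_C_ne_zero z)) hr0), rootMultiplicity_X_sub_C_pow,
    rootMultiplicity_eq_zero hr, add_zero]

/-- Near `a`, a nonconstant polynomial is a power of a local coordinate. -/
lemma exists_local_coordinate {p : ℂ[X]} (hp : 0 < p.natDegree) (a : ℂ) :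
    ∃ u : ℂ → ℂ, AnalyticAt ℂ u a ∧ u a = 0 ∧ deriv u a ≠ 0 ∧
      ∀ x, p.eval x - p.eval a = u x ^ localDeg p a := by
  have hm := localDeg_pos hp a
  obtain ⟨r, hr, hra⟩ := exists_sub_C_eval_eq hp a
  set m := localDeg p a
  obtain ⟨c, hc⟩ := IsAlgClosed.exists_pow_nat_eq (r.eval a) hm
  have hc0 : c ≠ 0 := by
    rintro rfl
    exact hra (by rw [← hc, zero_pow hm.ne'])
  set v : ℂ → ℂ := fun x => c * (r.eval x / r.eval a) ^ (1 / (m : ℂ)) with hv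
  have hva : AnalyticAt ℂ v a := by
    have hra' : AnalyticAt ℂ (fun x => r.eval x) a :=
      (Polynomial.differentiable r).analyticAt a
    refine analyticAt_const.mul (AnalyticAt.cpow (hra'.div_const) analyticAt_const ?_)
    simp [div_self hra]
  have hv0 : v a = c := by simp [hv, div_self hra]
  have hd : HasDerivAt (fun x => (x - a) * v x) c a := by
    refine (((hasDerivAt_id a).sub_const a).mul hva.differentiableAt.hasDerivAt).congr_deriv ?_
    simp [hv0]
  refine ⟨fun x => (x - a) * v x, (analyticAt_id.sub analyticAt_const).mul hva, by simp,
    by rwa [hd.deriv], fun x => ?_⟩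
  have hx := congrArg (eval x) hr
  simp only [eval_sub, eval_C, eval_mul, eval_pow, eval_X] at hx
  have hpow : v x ^ m = r.eval x := by
    simp only [hv, mul_pow, hc, one_div, Complex.cpow_nat_inv_pow _ hm.ne']
    field_simp
  rw [hx, mul_pow, hpow]

/-- Two analytic germs with equal `m`-th powers differ by a constant factor. -/
lemma AnalyticAt.exists_eventually_eq_mul_of_pow_eq {F G : ℂ → ℂ} {z : ℂ} {m : ℕ} (hm : 0 < m)
    (hF : AnalyticAt ℂ F z) (hG : AnalyticAt ℂ G z) (h : ∀ᶠ x in 𝓝 z, F x ^ m = G x ^ m) :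
    ∃ c : ℂ, ∀ᶠ x in 𝓝 z, F x = c * G x := by
  by_contra! hne
  have hprod : ∃ᶠ x in 𝓝[≠] z, F x ^ m ≠ G x ^ m := by
    refine Eventually.frequently ?_
    have : ∀ᶠ x in 𝓝[≠] z, ∀ c ∈ nthRootsFinset m (1 : ℂ), F x - c * G x ≠ 0 := by
      rw [Finset.eventually_all]
      intro c _
      have hFG := hF.sub (analyticAt_const (v := c).mul hG)
      refine hFG.eventually_eq_zero_or_eventually_ne_zero.resolve_left ?_
      intro h0
      exact hne c (h0.mono fun x hx => not_not.mpr (sub_eq_zero.mp hx))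
    filter_upwards [this] with x hx
    rw [← sub_ne_zero, (Complex.isPrimitiveRoot_exp m hm.ne').pow_sub_pow_eq_prod_sub_mul _ _ hm]
    exact Finset.prod_ne_zero_iff.mpr hx
  exact hprod ((h.filter_mono nhdsWithin_le_nhds).mono fun x hx => not_not.mpr hx)

lemma exists_injOn_nhds {u : ℂ → ℂ} {a : ℂ} (hu : AnalyticAt ℂ u a) (h : deriv u a ≠ 0) :
    ∃ s ∈ 𝓝 a, Set.InjOn u s := by
  have hs := hu.hasStrictDerivAt
  obtain ⟨g, hg⟩ : ∃ g : ℂ → ℂ, ∀ᶠ x in 𝓝 a, g (u x) = x :=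
    ⟨_, hs.eventually_left_inverse h⟩
  exact ⟨_, hg, Set.LeftInvOn.injOn (f₁' := g) fun x hx => hx⟩

lemma exists_eventually_eq_const_mul_pow {f p : ℂ[X]} (hf : 0 < f.natDegree)
    (hp : 0 < p.natDegree) {z : ℂ} {u ζ : ℂ → ℂ} (hu : AnalyticAt ℂ u (p.eval z))
    (hζ : AnalyticAt ℂ ζ z)
    (hfu : ∀ x, f.eval x - f.eval (p.eval z) = u x ^ localDeg f (p.eval z))
    (hζh : ∀ x, (f.comp p).eval x - (f.comp p).eval z = ζ x ^ localDeg (f.comp p) z) :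
    ∃ c : ℂ, ∀ᶠ x in 𝓝 z, u (p.eval x) = c * ζ x ^ localDeg p z := by
  have hp' : AnalyticAt ℂ (fun x => p.eval x) z := p.differentiable.analyticAt z
  refine AnalyticAt.exists_eventually_eq_mul_of_pow_eq (localDeg_pos hf (p.eval z))
    (AnalyticAt.fun_comp hu hp') (hζ.pow _) (Eventually.of_forall fun x => ?_)
  rw [← hfu, ← pow_mul, mul_comm, ← localDeg_comp hf hp, ← hζh, eval_comp, eval_comp]

/-- If `f ∘ p = g ∘ q` and `r` divides the local degrees of `p` and `q` at `z`, both `p` and `q` are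
invariant under a local automorphism of order `r` at `z`. -/
lemma eventually_exists_ne_eval_eq {f g p q : ℂ[X]} (hf : 0 < f.natDegree) (hg : 0 < g.natDegree)
    (hp : 0 < p.natDegree) (hq : 0 < q.natDegree) (h : f.comp p = g.comp q) {z : ℂ} {r : ℕ}
    (hr : 1 < r) (hrp : r ∣ localDeg p z) (hrq : r ∣ localDeg q z) :
    ∀ᶠ x in 𝓝[≠] z, ∃ y, x ≠ y ∧ p.eval x = p.eval y ∧ q.eval x = q.eval y := by
  have hh : 0 < (f.comp p).natDegree := by
    rw [natDegree_comp]
    positivity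
  obtain ⟨ζ, hζ, hζz, hζ', hζh⟩ := exists_local_coordinate hh z
  obtain ⟨u, hu, -, hu', huf⟩ := exists_local_coordinate hf (p.eval z)
  obtain ⟨v, hv, -, hv', hvg⟩ := exists_local_coordinate hg (q.eval z)
  obtain ⟨c, hc⟩ := exists_eventually_eq_const_mul_pow hf hp hu hζ huf hζh
  obtain ⟨d, hd⟩ := exists_eventually_eq_const_mul_pow hg hq hv hζ hvg (by rwa [← h])
  obtain ⟨s, hs, hsu⟩ := exists_injOn_nhds hu hu'
  obtain ⟨t, ht, htv⟩ := exists_injOn_nhds hv hv'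
  obtain ⟨w, hw, hwζ⟩ := exists_injOn_nhds hζ hζ'
  have hN : ∀ᶠ x in 𝓝 z, (u (p.eval x) = c * ζ x ^ localDeg p z ∧
      v (q.eval x) = d * ζ x ^ localDeg q z) ∧ p.eval x ∈ s ∧ q.eval x ∈ t ∧ x ∈ w :=
    (hc.and hd).and ((p.continuous.continuousAt.eventually_mem hs).and
      ((q.continuous.continuousAt.eventually_mem ht).and hw))
  set ω := Complex.exp (2 * Real.pi * Complex.I / r)
  have hω : IsPrimitiveRoot ω r := Complex.isPrimitiveRoot_exp r (by omega)
  have hmap : map ζ (𝓝 z) = 𝓝 0 := by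
    rw [hζ.hasStrictDerivAt.map_nhds_eq hζ', hζz]
  have htend : Tendsto (fun x => ω * ζ x) (𝓝 z) (𝓝 0) := by
    have := hζ.continuousAt.tendsto.const_mul ω
    rwa [hζz, mul_zero] at this
  have himage := htend (hmap ▸ image_mem_map hN)
  filter_upwards [nhdsWithin_le_nhds hN, nhdsWithin_le_nhds himage, self_mem_nhdsWithin]
    with x ⟨⟨hcx, hdx⟩, hsx, htx, hwx⟩ ⟨y, ⟨⟨hcy, hdy⟩, hsy, hty, hwy⟩, hyx⟩ hxz
  refine ⟨y, ?_, hsu hsx hsy ?_, htv htx hty ?_⟩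
  · rintro rfl
    have h0 : ζ x = 0 := by
      by_contra hne
      exact hω.ne_one hr (mul_right_cancel₀ hne (hyx.symm.trans (one_mul _).symm))
    exact hxz (hwζ hwx (mem_of_mem_nhds hw) (h0.trans hζz.symm))
  · rw [hcx, hcy, hyx, mul_pow, (hω.pow_eq_one_iff_dvd _).mpr hrp, one_mul]
  · rw [hdx, hdy, hyx, mul_pow, (hω.pow_eq_one_iff_dvd _).mpr hrq, one_mul]

lemma coprime_localDeg {f g p q : ℂ[X]} (hf : 0 < f.natDegree) (hg : 0 < g.natDegree)
    (hp : 0 < p.natDegree) (hq : 0 < q.natDegree) (h : f.comp p = g.comp q)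
    (hpq : NoCommonRightFactor p q) (z : ℂ) : (localDeg p z).Coprime (localDeg q z) := by
  by_contra hcop
  have hr : 1 < (localDeg p z).gcd (localDeg q z) :=
    lt_of_le_of_ne (Nat.gcd_pos_of_pos_left _ (localDeg_pos hp z)) (Ne.symm hcop)
  obtain ⟨s, hs0, hs⟩ := hpq.exists_injective hp
  have hroot : ∀ᶠ x in 𝓝[≠] z, s.eval x ≠ 0 := by
    have hfin : ({x | s.eval x = 0} \ {z}).Finite :=
      (s.rootSet_finite ℂ).subset fun x hx => (mem_rootSet.mpr ⟨hs0, by simpa using hx.1⟩)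
    filter_upwards [nhdsWithin_le_nhds (hfin.isClosed.isOpen_compl.mem_nhds (by simp)),
      self_mem_nhdsWithin] with x hx hxz h0
    exact hx ⟨h0, hxz⟩
  obtain ⟨x, hx, y, hxy, hpxy, hqxy⟩ := (hroot.and (eventually_exists_ne_eval_eq hf hg hp hq h hr
    (Nat.gcd_dvd_left _ _) (Nat.gcd_dvd_right _ _))).exists
  exact hxy (hs x y hpxy hqxy hx)

end LocalDegree

theorem stmt_19 (f g p q : Polynomial ℂ)
    (hf : 0 < f.natDegree) (hg : 0 < g.natDegree)
    (hp : 0 < p.natDegree) (hq : 0 < q.natDegree)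
    (heq : f.comp p = g.comp q)
    (hirr : Irreducible (curvePoly f g))
    (hnc : NoCommonRightFactor p q) :
    ∀ z : ℂ,
      localDeg (f.comp p) z = Nat.lcm (localDeg f (p.eval z)) (localDeg g (q.eval z)) := by
  intro z
  have hcop := coprime_localDeg hf hg hp hq heq hnc z
  have hfp := localDeg_comp hf hp z
  have hgq := localDeg_comp hg hq z
  rw [← heq] at hgq
  refine Nat.dvd_antisymm ?_ (Nat.lcm_dvd ⟨_, hfp⟩ ⟨_, hgq⟩)
  obtain ⟨a, ha⟩ := Nat.dvd_lcm_left (localDeg f (p.eval z)) (localDeg g (q.eval z))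
  obtain ⟨b, hb⟩ := Nat.dvd_lcm_right (localDeg f (p.eval z)) (localDeg g (q.eval z))
  set l := Nat.lcm (localDeg f (p.eval z)) (localDeg g (q.eval z))
  have hlp : localDeg (f.comp p) z ∣ localDeg p z * l := by
    rw [hfp, ha, mul_comm, mul_left_comm, ← mul_assoc]
    exact ⟨a, by ring⟩
  have hlq : localDeg (f.comp p) z ∣ localDeg q z * l := by
    rw [hgq, hb]
    exact ⟨b, by ring⟩
  have := Nat.dvd_gcd hlp hlq
  rwa [Nat.gcd_mul_right, hcop, one_mul] at this
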